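/- arXiv:2304.03773 — 5 statements merged into one kernel-verified Lean document; each statement's English description precedes it below -/
import Mathlib

section
/- Let M be a finite MDP and let π* be an optimal policy for M. Fix δ ∈ (0,1] and define the pruned action set Ã(s) = { a ∈ A : Q^{π*}_M(s,a) ≥ δ · max_{a'∈A} Q^{π*}_M(s,a') }. Then every policy π satisfying the safety constraint ∀s, V^π_M(s) ≥ δ · V^{π*}_M(s) selects only unpruned actions: for every state s, π(s) ∈ Ã(s). Equivalently, the set Π̃ of policies choosing actions only from Ã is a superset of the set Π_δ of policies satisfying the safety constraint. -/
open Finset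

/-- A finite MDP with state space `S` and action space `A`:
transition probabilities `T`, rewards `R`, discount factor `γ ∈ [0,1)`. -/
structure MDP (S A : Type) [Fintype S] [Fintype A] where
  T : S → A → S → ℝ
  R : S → A → ℝ
  γ : ℝ
  T_nonneg : ∀ s a s', 0 ≤ T s a s'
  T_sum_one : ∀ s a, ∑ s' : S, T s a s' = 1
  γ_nonneg : 0 ≤ γ
  γ_lt_one : γ < 1

variable {S A : Type} [Fintype S] [Fintype A]

/-- `V` assigns to each stationary deterministic policy its value function,
i.e. a solution of the Bellman equations (unique since `γ < 1`). -/
def IsValue (M : MDP S A) (V : (S → A) → S → ℝ) : Prop :=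
  ∀ π : S → A, ∀ s : S, V π s = M.R s (π s) + M.γ * ∑ s' : S, M.T s (π s) s' * V π s'

/-- The Q-function `Q^π_M(s,a)` induced by the value function `V`. -/
def Qf (M : MDP S A) (V : (S → A) → S → ℝ) (π : S → A) (s : S) (a : A) : ℝ :=
  M.R s a + M.γ * ∑ s' : S, M.T s a s' * V π s'

/-- `πstar` is an optimal policy for `M`. -/
def IsOptimal (M : MDP S A) (V : (S → A) → S → ℝ) (πstar : S → A) : Prop :=
  ∀ π : S → A, ∀ s : S, V π s ≤ V πstar s

namespace MDP

/-- The minimum principle for discounted transition operators. -/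
theorem nonneg_of_discounted_sum_le [Nonempty S] (M : MDP S A) (π : S → A) (D : S → ℝ)
    (hD : ∀ s, M.γ * ∑ s', M.T s (π s) s' * D s' ≤ D s) (s : S) : 0 ≤ D s := by
  obtain ⟨m, hm⟩ := Finite.exists_min D
  have havg : D m ≤ ∑ s', M.T m (π m) s' * D s' := by
    calc D m = ∑ s', M.T m (π m) s' * D m := by rw [← Finset.sum_mul, M.T_sum_one, one_mul]
      _ ≤ _ := Finset.sum_le_sum fun s' _ =>
        mul_le_mul_of_nonneg_left (hm s') (M.T_nonneg _ _ _)
  have hγ : M.γ * D m ≤ D m := (mul_le_mul_of_nonneg_left havg M.γ_nonneg).trans (hD m)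
  have hmin : 0 ≤ D m := by nlinarith [M.γ_lt_one]
  exact hmin.trans (hm s)

theorem discounted_sum_nonneg (M : MDP S A) (s : S) (a : A) {D : S → ℝ} (hD : ∀ s, 0 ≤ D s) :
    0 ≤ M.γ * ∑ s', M.T s a s' * D s' :=
  mul_nonneg M.γ_nonneg <| Finset.sum_nonneg fun s' _ => mul_nonneg (M.T_nonneg _ _ _) (hD s')

theorem discounted_sum_sub (M : MDP S A) (V : (S → A) → S → ℝ) (π₁ π₂ : S → A) (s : S) (a : A) :
    M.γ * ∑ s', M.T s a s' * (V π₁ s' - V π₂ s') = Qf M V π₁ s a - Qf M V π₂ s a := by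
  simp only [Qf, mul_sub, Finset.sum_sub_distrib]
  ring

/-- Under an optimal policy, no one-step deviation improves on the value. -/
theorem qf_le_value_of_isOptimal (M : MDP S A) {V : (S → A) → S → ℝ}
    (hV : IsValue M V) {πstar : S → A} (hopt : IsOptimal M V πstar) (s : S) (a : A) :
    Qf M V πstar s a ≤ V πstar s := by
  classical
  have : Nonempty S := ⟨s⟩
  by_contra! hlt
  set π' := Function.update πstar s a with hπ'
  have hs : π' s = a := Function.update_self ..
  have hle (x : S) : V πstar x ≤ Qf M V πstar x (π' x) := by
    by_cases hx : x = s
    · subst hx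
      rw [hs]
      exact hlt.le
    · rw [hπ', Function.update_of_ne hx]
      exact (hV πstar x).le
  have hval (x : S) : V π' x = Qf M V π' x (π' x) := hV π' x
  have hD : ∀ x, 0 ≤ V π' x - V πstar x :=
    M.nonneg_of_discounted_sum_le π' _ fun x => by
      rw [M.discounted_sum_sub]
      linarith [hval x, hle x]
  have hnonneg := M.discounted_sum_nonneg s a hD
  rw [M.discounted_sum_sub] at hnonneg
  have hval_s := hval s
  rw [hs] at hval_s
  linarith [hopt π' s]

end MDP

/-- every policy satisfying the safety constraint
`∀ s, V^π(s) ≥ δ·V^{π*}(s)` selects only unpruned actions, i.e.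
`Q^{π*}(s, π(s)) ≥ δ · max_{a'} Q^{π*}(s, a')` for every state `s`. -/
theorem action_pruning_superset
    [Nonempty S] [Nonempty A]
    (M : MDP S A) (V : (S → A) → S → ℝ) (hV : IsValue M V)
    (πstar : S → A) (hopt : IsOptimal M V πstar)
    (δ : ℝ) (hδ0 : 0 < δ) (hδ1 : δ ≤ 1)
    (π : S → A) (hsafe : ∀ s : S, V π s ≥ δ * V πstar s) :
    ∀ s : S, Qf M V πstar s (π s) ≥
      δ * (Finset.univ.sup' Finset.univ_nonempty fun a' : A => Qf M V πstar s a') := by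
  intro s
  have hmax : (Finset.univ.sup' Finset.univ_nonempty fun a' : A => Qf M V πstar s a')
      ≤ V πstar s :=
    Finset.sup'_le _ _ fun a _ => M.qf_le_value_of_isOptimal hV hopt s a
  have hnonneg := M.discounted_sum_nonneg s (π s) fun s' => sub_nonneg.2 (hopt π s')
  rw [M.discounted_sum_sub] at hnonneg
  have hval : V π s = Qf M V π s (π s) := hV π s
  linarith [hsafe s, mul_le_mul_of_nonneg_left hmax hδ0.le]
end

section
/- Let M be a finite MDP, π* an optimal policy for M, and δ ∈ (0,1]. Suppose an action a at state s is pruned, i.e., Q^{π*}_M(s,a) < δ · max_{a'∈A} Q^{π*}_M(s,a'). Then every policy π with π(s) = a violates the safety constraint at s: V^π_M(s) < δ · V^{π*}_M(s). -/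
open Finset

variable {S A : Type} [Fintype S] [Fintype A]

/-- Discounted minimum principle: a function dominating its discounted expected successor value
is nonnegative. -/
theorem MDP.nonneg_of_discounted_le (M : MDP S A) (π : S → A) (f : S → ℝ)
    (hf : ∀ x, M.γ * ∑ y, M.T x (π x) y * f y ≤ f x) (x : S) : 0 ≤ f x := by
  have : Nonempty S := ⟨x⟩
  obtain ⟨m, hm⟩ := Finite.exists_min f
  have hsum : f m ≤ ∑ y, M.T m (π m) y * f y := by
    calc f m = ∑ y, M.T m (π m) y * f m := by rw [← Finset.sum_mul, M.T_sum_one, one_mul]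
      _ ≤ _ := Finset.sum_le_sum fun y _ => mul_le_mul_of_nonneg_left (hm y) (M.T_nonneg _ _ _)
  have hstep : M.γ * f m ≤ f m :=
    (mul_le_mul_of_nonneg_left hsum M.γ_nonneg).trans (hf m)
  have hmin : 0 ≤ f m := by
    by_contra! h
    nlinarith [M.γ_lt_one]
  exact hmin.trans (hm x)

theorem IsValue.eq_Qf {M : MDP S A} {V : (S → A) → S → ℝ} (hV : IsValue M V)
    (π : S → A) (s : S) : V π s = Qf M V π s (π s) :=
  hV π s

theorem Qf_mono {M : MDP S A} {V : (S → A) → S → ℝ} {π π' : S → A}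
    (h : ∀ s, V π s ≤ V π' s) (s : S) (a : A) : Qf M V π s a ≤ Qf M V π' s a := by
  unfold Qf
  gcongr with y
  · exact M.γ_nonneg
  · exact M.T_nonneg _ _ _
  · exact h y

/-- Policy improvement: a policy that is greedy-improving against `π` has a larger value. -/
theorem IsValue.le_of_le_Qf {M : MDP S A} {V : (S → A) → S → ℝ} (hV : IsValue M V)
    {π π' : S → A} (h : ∀ s, V π s ≤ Qf M V π s (π' s)) (s : S) : V π s ≤ V π' s := by
  refine sub_nonneg.mp (M.nonneg_of_discounted_le π' (fun x => V π' x - V π x) (fun x => ?_) s)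
  have h1 := hV π' x
  have h2 := h x
  unfold Qf at h2
  simp only [mul_sub, Finset.sum_sub_distrib]
  linarith

/-- An optimal policy satisfies the Bellman optimality inequality. -/
theorem IsOptimal.Qf_le {M : MDP S A} {V : (S → A) → S → ℝ} (hV : IsValue M V)
    {πstar : S → A} (hopt : IsOptimal M V πstar) (s : S) (a : A) :
    Qf M V πstar s a ≤ V πstar s := by
  classical
  by_contra! hlt
  have himp : ∀ x, V πstar x ≤ V (Function.update πstar s a) x := by
    refine hV.le_of_le_Qf fun x => ?_
    obtain rfl | hx := eq_or_ne x s
    · simpa using hlt.le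
    · simpa [hx] using (hV.eq_Qf πstar x).le
  have hs := hV.eq_Qf (Function.update πstar s a) s
  rw [Function.update_self] at hs
  linarith [Qf_mono (M := M) himp s a, hopt (Function.update πstar s a) s]

/-- if action `a` is pruned at state `s`
(`Q^{π*}(s,a) < δ · max_{a'} Q^{π*}(s,a')`), then every policy choosing `a` at `s`
violates the safety constraint at `s`. -/
theorem pruned_action_violates
    [Nonempty S] [Nonempty A]
    (M : MDP S A) (V : (S → A) → S → ℝ) (hV : IsValue M V)
    (πstar : S → A) (hopt : IsOptimal M V πstar)
    (δ : ℝ) (hδ0 : 0 < δ) (hδ1 : δ ≤ 1)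
    (s : S) (a : A)
    (hpruned : Qf M V πstar s a <
      δ * (Finset.univ.sup' Finset.univ_nonempty fun a' : A => Qf M V πstar s a'))
    (π : S → A) (hπ : π s = a) :
    V π s < δ * V πstar s := by
  subst hπ
  calc V π s = Qf M V π s (π s) := hV.eq_Qf π s
    _ ≤ Qf M V πstar s (π s) := Qf_mono (hopt π) s (π s)
    _ < _ := hpruned
    _ ≤ δ * V πstar s := by
      gcongr
      exact Finset.sup'_le _ _ fun a' _ => hopt.Qf_le hV s a'
end

section
/- (Policy descent step) Let M be a finite MDP and let π and π' be two stationary deterministic policies that differ in exactly one state: there exists s_i ∈ S with π'(s_i) ≠ π(s_i) and π'(s_j) = π(s_j) for all s_j ≠ s_i. If Q^π_M(s_i, π'(s_i)) ≤ V^π_M(s_i), then π' is no better than π everywhere: V^{π'}_M(s) ≤ V^π_M(s) for all s ∈ S. -/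
open Finset

variable {S A : Type} [Fintype S] [Fintype A]

/-- Maximum principle for discounted chains: a function dominated by its discounted
one-step expectation is nonpositive. -/
theorem MDP.nonpos_of_le_discounted_sum [Nonempty S] (M : MDP S A) (π : S → A) (d : S → ℝ)
    (hd : ∀ s, d s ≤ M.γ * ∑ s' : S, M.T s (π s) s' * d s') (s : S) : d s ≤ 0 := by
  obtain ⟨m, hm⟩ := Finite.exists_max d
  have hsum : ∑ s' : S, M.T m (π m) s' * d s' ≤ d m := by
    calc ∑ s' : S, M.T m (π m) s' * d s' ≤ ∑ s' : S, M.T m (π m) s' * d m :=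
          Finset.sum_le_sum fun s' _ => mul_le_mul_of_nonneg_left (hm s') (M.T_nonneg _ _ _)
      _ = d m := by rw [← Finset.sum_mul, M.T_sum_one, one_mul]
  have hle : d m ≤ M.γ * d m := (hd m).trans (mul_le_mul_of_nonneg_left hsum M.γ_nonneg)
  have hm0 : d m ≤ 0 := by nlinarith [M.γ_lt_one]
  exact (hm s).trans hm0

/-- If no action chosen by `π'` is an improvement over `π`, then `π'` is nowhere better. -/
theorem IsValue.le_of_Qf_le [Nonempty S] {M : MDP S A} {V : (S → A) → S → ℝ}
    (hV : IsValue M V) {π π' : S → A} (hQ : ∀ s, Qf M V π s (π' s) ≤ V π s) (s : S) :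
    V π' s ≤ V π s := by
  refine sub_nonpos.mp (M.nonpos_of_le_discounted_sum π' (fun t => V π' t - V π t) ?_ s)
  intro t
  have hVt := hV π' t
  have hQt := hQ t
  simp only [Qf] at hQt
  simp only [mul_sub, Finset.sum_sub_distrib]
  linarith

/-- policy descent step: if `π'` differs from `π` in exactly one state
`s_i` and `Q^π(s_i, π'(s_i)) ≤ V^π(s_i)`, then `V^{π'} ≤ V^π` everywhere. -/
theorem policy_descent_step
    [Nonempty S] [Nonempty A]
    (M : MDP S A) (V : (S → A) → S → ℝ) (hV : IsValue M V)
    (π π' : S → A) (si : S)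
    (hdiff : π' si ≠ π si)
    (hsame : ∀ sj : S, sj ≠ si → π' sj = π sj)
    (hQ : Qf M V π si (π' si) ≤ V π si) :
    ∀ s : S, V π' s ≤ V π s := by
  refine hV.le_of_Qf_le fun s => ?_
  by_cases h : s = si
  · rwa [h]
  · rw [hsame s h]
    exact (hV π s).ge
end

section
/- (Policy ascent step) Let M be a finite MDP and let π and π' be two stationary deterministic policies that differ in exactly one state: there exists s_i ∈ S with π'(s_i) ≠ π(s_i) and π'(s_j) = π(s_j) for all s_j ≠ s_i. If Q^π_M(s_i, π'(s_i)) ≥ V^π_M(s_i), then π' is no worse than π everywhere: V^{π'}_M(s) ≥ V^π_M(s) for all s ∈ S. -/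
open Finset

variable {S A : Type} [Fintype S] [Fintype A]

/-- A subsolution `W` of the Bellman equations of `π` lies below every solution `U`. -/
theorem MDP.subsolution_le (M : MDP S A) (π : S → A) {U W : S → ℝ}
    (hU : ∀ s, U s = M.R s (π s) + M.γ * ∑ s', M.T s (π s) s' * U s')
    (hW : ∀ s, W s ≤ M.R s (π s) + M.γ * ∑ s', M.T s (π s) s' * W s') (s : S) :
    W s ≤ U s := by
  have : Nonempty S := ⟨s⟩
  obtain ⟨m, hm⟩ := Finite.exists_min fun s => U s - W s
  have hsum : U m - W m ≤
      ∑ s', M.T m (π m) s' * U s' - ∑ s', M.T m (π m) s' * W s' := by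
    calc U m - W m = ∑ s', M.T m (π m) s' * (U m - W m) := by
          rw [← Finset.sum_mul, M.T_sum_one, one_mul]
      _ ≤ ∑ s', M.T m (π m) s' * (U s' - W s') :=
          Finset.sum_le_sum fun s' _ => mul_le_mul_of_nonneg_left (hm s') (M.T_nonneg _ _ _)
      _ = _ := by simp only [mul_sub, Finset.sum_sub_distrib]
  have hγ := mul_le_mul_of_nonneg_left hsum M.γ_nonneg
  have hmin : 0 ≤ U m - W m := by
    refine nonneg_of_mul_nonneg_right ?_ (sub_pos.2 M.γ_lt_one)
    linarith [hU m, hW m]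
  linarith [hm s]

/-- policy ascent step: if `π'` differs from `π` in exactly one state
`s_i` and `Q^π(s_i, π'(s_i)) ≥ V^π(s_i)`, then `V^{π'} ≥ V^π` everywhere. -/
theorem policy_ascent_step
    [Nonempty S] [Nonempty A]
    (M : MDP S A) (V : (S → A) → S → ℝ) (hV : IsValue M V)
    (π π' : S → A) (si : S)
    (hdiff : π' si ≠ π si)
    (hsame : ∀ sj : S, sj ≠ si → π' sj = π sj)
    (hQ : Qf M V π si (π' si) ≥ V π si) :
    ∀ s : S, V π' s ≥ V π s := by
  refine M.subsolution_le π' (hV π') fun s => ?_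
  by_cases hs : s = si
  · subst hs
    exact hQ
  · rw [hsame s hs]
    exact (hV π s).le
end

section
/- (Branch-pruning soundness of Policy Descent Tree search) Let M_R be a finite MDP, π* an optimal policy for M_R, and δ ∈ (0,1]. Suppose π' is reachable from π by a finite sequence of single-action policy descent steps, i.e., there are policies π = π_0, π_1, …, π_n = π' where each π_{k+1} differs from π_k in exactly one state s_k and Q^{π_k}_{M_R}(s_k, π_{k+1}(s_k)) ≤ V^{π_k}_{M_R}(s_k). If π violates the safety bound at some state s, i.e., V^π_{M_R}(s) < δ · V^{π*}_{M_R}(s), then π' also violates it at s: V^{π'}_{M_R}(s) < δ · V^{π*}_{M_R}(s). -/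
open Finset

variable {S A : Type} [Fintype S] [Fintype A]

/-- Policy descent: if no action of `π'` improves on `π` in one step, then the value of `π'`
is pointwise at most the value of `π`. -/
theorem IsValue.le_of_forall_Qf_le {M : MDP S A} {V : (S → A) → S → ℝ} (hV : IsValue M V)
    {π π' : S → A} (h : ∀ s, Qf M V π s (π' s) ≤ V π s) (s : S) : V π' s ≤ V π s := by
  have : Nonempty S := ⟨s⟩
  obtain ⟨m, hm⟩ := Finite.exists_max fun x => V π' x - V π x
  have hsum : ∑ x, M.T m (π' m) x * V π' x - ∑ x, M.T m (π' m) x * V π x ≤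
      V π' m - V π m := by
    calc
      _ = ∑ x, M.T m (π' m) x * (V π' x - V π x) := by
        simp only [mul_sub, Finset.sum_sub_distrib]
      _ ≤ ∑ x, M.T m (π' m) x * (V π' m - V π m) :=
        Finset.sum_le_sum fun x _ => mul_le_mul_of_nonneg_left (hm x) (M.T_nonneg _ _ _)
      _ = V π' m - V π m := by rw [← Finset.sum_mul, M.T_sum_one, one_mul]
  have hmax : V π' m - V π m ≤ 0 := by
    have hdescent := h m
    have hbellman := hV π' m
    have hdisc := mul_le_mul_of_nonneg_left hsum M.γ_nonneg
    have hγ := M.γ_lt_one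
    unfold Qf at hdescent
    by_contra! hpos
    nlinarith
  linarith [hm s]

/-- branch-pruning soundness of PDT: if `π'` is reachable from `π` by a
finite sequence of single-action policy descent steps and `π` violates the safety bound
at some state `s`, then `π'` also violates it at `s`. -/
theorem pdt_branch_pruning_sound
    [Nonempty S] [Nonempty A]
    (MR : MDP S A) (V : (S → A) → S → ℝ) (hV : IsValue MR V)
    (πstar : S → A) (hopt : IsOptimal MR V πstar)
    (δ : ℝ) (hδ0 : 0 < δ) (hδ1 : δ ≤ 1)
    (π π' : S → A) (n : ℕ) (πseq : ℕ → S → A)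
    (h0 : πseq 0 = π) (hn : πseq n = π')
    (hsteps : ∀ k : ℕ, k < n → ∃ sk : S,
      πseq (k+1) sk ≠ πseq k sk ∧
      (∀ s : S, s ≠ sk → πseq (k+1) s = πseq k s) ∧
      Qf MR V (πseq k) sk (πseq (k+1) sk) ≤ V (πseq k) sk)
    (s : S) (hviol : V π s < δ * V πstar s) :
    V π' s < δ * V πstar s := by
  subst h0 hn
  have hle : ∀ k ≤ n, V (πseq k) s ≤ V (πseq 0) s := by
    intro k
    induction k with
    | zero => exact fun _ => le_rfl
    | succ k ih =>
      intro hk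
      obtain ⟨sk, -, hsame, hQ⟩ := hsteps k hk
      refine (hV.le_of_forall_Qf_le (fun x => ?_) s).trans (ih (Nat.le_of_succ_le hk))
      by_cases hx : x = sk
      · exact hx ▸ hQ
      · rw [hsame x hx]
        exact (hV (πseq k) x).ge
  exact (hle n le_rfl).trans_lt hviol
end
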